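/- Let U ⊆ ((Fin n) → ℝ) be open and, for t ∈ ℕ, let D^t := {p ∈ J^t : x(p) ∈ U}. Let T_σ (σ ∈ Fin m) be smooth functions on D^s whose Helmholtz–Sonin expressions all vanish: ∂^J_ν T_σ − (−1)^{|J|} E^J_σ(T_ν) = 0 on D^{2s} for all σ, ν ∈ Fin m and all multi-indices J with |J| ≤ s. Define the Tonti–Vainberg Lagrangian L on D^s by L(p) := Σ_{σ ∈ Fin m} y^σ(p) · ∫_0^1 T_σ(χ_t(p)) dt, where χ_t : D^s → D^s multiplies every coordinate y^σ_J (|J| ≤ s) of p by t and fixes the x-coordinates. Then L is smooth and E_σ(L) = T_σ on D^{2s} for every σ ∈ Fin m. (A differential equation satisfying the Helmholtz conditions is variational, with explicit Lagrangian.) -/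

import Mathlib

open scoped BigOperators

namespace JetVar

/-- Multi-indices on `Fin n` of degree at most `r`. -/
abbrev MD (n r : ℕ) : Type := {J : Fin n → ℕ // (∑ i, J i) ≤ r}

noncomputable instance (n r : ℕ) : Fintype (MD n r) :=
  Fintype.ofInjective
    (fun J : MD n r => fun i : Fin n =>
      (⟨J.1 i, Nat.lt_succ_of_le ((Finset.single_le_sum
        (fun j _ => Nat.zero_le (J.1 j)) (Finset.mem_univ i)).trans J.2)⟩ : Fin (r+1)))
    (fun _a _b h => Subtype.ext (funext fun i => congrArg Fin.val (congrFun h i)))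

/-- Index set for the `y` coordinates of the `r`-th order jet space. -/
abbrev JIdx (n m r : ℕ) : Type := Fin m × MD n r

/-- The `r`-th order jet coordinate space. -/
abbrev Jet (n m r : ℕ) : Type := ((Fin n) → ℝ) × (JIdx n m r → ℝ)

variable {n m : ℕ}

/-- The coordinate `x^i`. -/
def xc (i : Fin n) {r : ℕ} (p : Jet n m r) : ℝ := p.1 i

/-- The coordinate `y^σ_J` (with the convention that it is `0` for `|J| > r`). -/
def yc (σ : Fin m) (J : Fin n → ℕ) {r : ℕ} (p : Jet n m r) : ℝ :=
  if h : (∑ i, J i) ≤ r then p.2 (σ, ⟨J, h⟩) else 0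

/-- Partial derivative along the coordinate direction `x^i`. -/
noncomputable def pdX (i : Fin n) {r : ℕ} (f : Jet n m r → ℝ) (p : Jet n m r) : ℝ :=
  fderiv ℝ f p (Pi.single i 1, 0)

/-- Partial derivative along the coordinate direction `y^σ_J`
(by convention `0` for `|J| > r`). -/
noncomputable def pdY (σ : Fin m) (J : Fin n → ℕ) {r : ℕ} (f : Jet n m r → ℝ)
    (p : Jet n m r) : ℝ :=
  if h : (∑ i, J i) ≤ r then fderiv ℝ f p (0, Pi.single (σ, (⟨J, h⟩ : MD n r)) 1) else 0

/-- Projection `J^s → J^r` for `r ≤ s`, forgetting higher order coordinates. -/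
def projJet {r s : ℕ} (h : r ≤ s) (p : Jet n m s) : Jet n m r :=
  (p.1, fun q => p.2 (q.1, ⟨q.2.1, q.2.2.trans h⟩))

/-- `J + e_i`. -/
def addE (J : Fin n → ℕ) (i : Fin n) : Fin n → ℕ := fun j => J j + (if j = i then 1 else 0)

/-- `J - e_i` (truncated subtraction). -/
def subE (J : Fin n → ℕ) (i : Fin n) : Fin n → ℕ := fun j => J j - (if j = i then 1 else 0)

/-- The `i`-th formal (total) derivative of a function on `J^r`, a function on `J^{r+1}`. -/
noncomputable def formalD (i : Fin n) {r : ℕ} (f : Jet n m r → ℝ) (p : Jet n m (r+1)) : ℝ :=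
  pdX i f (projJet (Nat.le_succ r) p)
    + ∑ q : JIdx n m r, yc q.1 (addE q.2.1 i) p * pdY q.1 q.2.1 f (projJet (Nat.le_succ r) p)

/-- Iterated formal derivatives along a list of directions. -/
noncomputable def formalDL {r : ℕ} : (l : List (Fin n)) → (Jet n m r → ℝ) →
    (Jet n m (r + l.length) → ℝ)
  | [], f => f
  | i :: l, f => formalD i (formalDL l f)

/-- The canonical list of directions attached to a multi-index
(each `i` repeated `J i` times, in increasing order of `i`). -/
def mlist (J : Fin n → ℕ) : List (Fin n) :=
  (List.finRange n).flatMap (fun i => List.replicate (J i) i)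

lemma mlist_length (J : Fin n → ℕ) : (mlist J).length = ∑ i, J i := by
  rw [mlist, List.length_flatMap]
  simp only [Function.comp_def, List.length_replicate]
  rw [Fin.sum_univ_def]

/-- The iterated formal derivative `d_I`, applying each `d_i` exactly `I i` times
(in increasing order of `i`); a function on `J^{r+|I|}`. -/
noncomputable def formalDI (I : Fin n → ℕ) {r : ℕ} (f : Jet n m r → ℝ)
    (p : Jet n m (r + ∑ i, I i)) : ℝ :=
  formalDL (mlist I) f (projJet (le_of_eq (by rw [mlist_length])) p)

/-- The Lie–Euler expression `E^I_σ(L)` of a function `L` on `J^r`, a function on `J^{2r}`. -/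
noncomputable def LieEuler {r : ℕ} (σ : Fin m) (I : Fin n → ℕ) (L : Jet n m r → ℝ)
    (p : Jet n m (2*r)) : ℝ :=
  ∑ J : MD n r,
    if h : (∑ i, (I i + J.1 i)) ≤ r then
      (-1:ℝ)^(∑ i, J.1 i) * (∏ i, (Nat.choose (I i + J.1 i) (I i) : ℝ)) *
        formalDI J.1 (pdY σ (fun i => I i + J.1 i) L)
          (projJet (by have := J.2; omega) p)
    else 0

/-- The Euler–Lagrange expression `E_σ(L)`. -/
noncomputable def EL {r : ℕ} (σ : Fin m) (L : Jet n m r → ℝ) : Jet n m (2*r) → ℝ :=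
  LieEuler σ (fun _ => 0) L


/-- The Tonti–Vainberg Lagrangian attached to a differential equation `T` on `D^s`. -/
noncomputable def TontiVainberg {n m s : ℕ} (T : Fin m → Jet n m s → ℝ)
    (p : Jet n m s) : ℝ :=
  ∑ σ : Fin m, yc σ (fun _ => 0) p * ∫ t in (0:ℝ)..1, T σ (p.1, fun q => t * p.2 q)

section Parametric
open Set Filter Topology MeasureTheory

theorem pint_hasFDerivAt {E F : Type} [NormedAddCommGroup E] [NormedSpace ℝ E]
    [FiniteDimensional ℝ E] [NormedAddCommGroup F] [NormedSpace ℝ F] [CompleteSpace F]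
    {D : Set E} (hD : IsOpen D) {f : ℝ × E → F}
    (hf : ContDiffOn ℝ (⊤:ℕ∞) f (univ ×ˢ D)) {p₀ : E} (hp : p₀ ∈ D) :
    HasFDerivAt (fun p => ∫ t in (0:ℝ)..1, f (t, p))
      (∫ t in (0:ℝ)..1, (fderiv ℝ f (t, p₀)).comp (ContinuousLinearMap.inr ℝ ℝ E)) p₀ := by
  have hO : IsOpen ((univ : Set ℝ) ×ˢ D) := isOpen_univ.prod hD
  have hf' : ContinuousOn (fderiv ℝ f) (univ ×ˢ D) :=
    hf.continuousOn_fderiv_of_isOpen hO (by simp)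
  have hg : ContinuousOn (fun z => (fderiv ℝ f z).comp (ContinuousLinearMap.inr ℝ ℝ E))
      (univ ×ˢ D) := hf'.clm_comp continuousOn_const
  obtain ⟨ε, hε, hball⟩ := Metric.nhds_basis_closedBall.mem_iff.1 (hD.mem_nhds hp)
  have : ProperSpace E := FiniteDimensional.proper ℝ E
  have hK : IsCompact (Icc (0:ℝ) 1 ×ˢ Metric.closedBall p₀ ε) :=
    isCompact_Icc.prod (isCompact_closedBall _ _)
  obtain ⟨C, hC⟩ := hK.exists_bound_of_continuousOn
    (hg.mono (prod_mono (subset_univ _) hball))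
  have hcf : ∀ p ∈ D, Continuous (fun t : ℝ => f (t, p)) := fun p hp =>
    hf.continuousOn.comp_continuous (by fun_prop) (fun t => ⟨mem_univ _, hp⟩)
  have hcg : Continuous (fun t : ℝ => (fderiv ℝ f (t, p₀)).comp
      (ContinuousLinearMap.inr ℝ ℝ E)) :=
    hg.comp_continuous (f := fun t : ℝ => (t, p₀)) (by fun_prop) (fun t => ⟨mem_univ _, hp⟩)
  refine intervalIntegral.hasFDerivAt_integral_of_dominated_of_fderiv_le
    (F := fun p t => f (t, p))
    (F' := fun p t => (fderiv ℝ f (t, p)).comp (ContinuousLinearMap.inr ℝ ℝ E))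
    (bound := fun _ => C) (s := Metric.closedBall p₀ ε)
    (Metric.closedBall_mem_nhds _ hε) ?_ ?_ ?_ ?_ ?_ ?_
  · filter_upwards [hD.mem_nhds hp] with p hp
    exact (hcf p hp).aestronglyMeasurable
  · exact (hcf p₀ hp).intervalIntegrable _ _
  · exact hcg.aestronglyMeasurable
  · refine Eventually.of_forall fun t ht x hx => hC (t, x) ⟨?_, hx⟩
    rw [uIoc_of_le zero_le_one] at ht
    exact ⟨ht.1.le, ht.2⟩
  · exact intervalIntegrable_const
  · refine Eventually.of_forall fun t ht x hx => ?_
    have h1 : HasFDerivAt f (fderiv ℝ f (t, x)) (t, x) :=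
      ((hf.differentiableOn (by simp)).differentiableAt
        (hO.mem_nhds ⟨mem_univ _, hball hx⟩)).hasFDerivAt
    exact h1.comp x (hasFDerivAt_prodMk_right t x)

theorem pint_contDiffOn_nat {E : Type} [NormedAddCommGroup E] [NormedSpace ℝ E]
    [FiniteDimensional ℝ E] {D : Set E} (hD : IsOpen D) (k : ℕ) :
    ∀ {F : Type} [NormedAddCommGroup F] [NormedSpace ℝ F] [CompleteSpace F] (f : ℝ × E → F),
    ContDiffOn ℝ (⊤:ℕ∞) f (univ ×ˢ D) →
    ContDiffOn ℝ k (fun p => ∫ t in (0:ℝ)..1, f (t, p)) D := by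
  have hO : IsOpen ((univ : Set ℝ) ×ˢ D) := isOpen_univ.prod hD
  induction k with
  | zero =>
    intro F _ _ _ f hf
    rw [Nat.cast_zero, contDiffOn_zero]
    exact fun p hp => (pint_hasFDerivAt hD hf hp).continuousAt.continuousWithinAt
  | succ k ih =>
    intro F _ _ _ f hf
    rw [Nat.cast_succ, contDiffOn_succ_iff_fderiv_of_isOpen hD]
    refine ⟨fun p hp => (pint_hasFDerivAt hD hf hp).differentiableAt.differentiableWithinAt,
      fun h => by simp at h, ?_⟩
    refine (ih (fun z => (fderiv ℝ f z).comp (ContinuousLinearMap.inr ℝ ℝ E)) ?_).congr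
      fun p hp => (pint_hasFDerivAt hD hf hp).fderiv
    have : ContDiffOn ℝ (⊤:ℕ∞) (fderiv ℝ f) (univ ×ˢ D) :=
      hf.fderiv_of_isOpen hO (by simp)
    exact this.clm_comp contDiffOn_const

theorem pint_contDiffOn {E : Type} [NormedAddCommGroup E] [NormedSpace ℝ E]
    [FiniteDimensional ℝ E] {D : Set E} (hD : IsOpen D)
    {F : Type} [NormedAddCommGroup F] [NormedSpace ℝ F] [CompleteSpace F] {f : ℝ × E → F}
    (hf : ContDiffOn ℝ (⊤:ℕ∞) f (univ ×ˢ D)) :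
    ContDiffOn ℝ (⊤:ℕ∞) (fun p => ∫ t in (0:ℝ)..1, f (t, p)) D :=
  contDiffOn_infty.2 fun k => pint_contDiffOn_nat hD k f hf
end Parametric
section Inf
open Set Filter Topology MeasureTheory

/-- infinite jets (a plain vector space) -/
abbrev JInf (n m : ℕ) : Type := ((Fin n) → ℝ) × (Fin m × (Fin n → ℕ) → ℝ)

/-- truncation -/
def trunc (r : ℕ) (P : JInf n m) : Jet n m r := (P.1, fun q => P.2 (q.1, q.2.1))

/-- the cylinder over `U` -/
def Cyl (n m r : ℕ) (U : Set (Fin n → ℝ)) : Set (Jet n m r) := {p | p.1 ∈ U}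

theorem isOpen_Cyl {r : ℕ} {U : Set (Fin n → ℝ)} (hU : IsOpen U) : IsOpen (Cyl n m r U) :=
  hU.preimage continuous_fst

/-- total derivative vector -/
def W (i : Fin n) (P : JInf n m) : JInf n m :=
  (Pi.single i 1, fun q => P.2 (q.1, addE q.2 i))

/-- total derivative on infinite jets -/
noncomputable def TD (i : Fin n) (F : JInf n m → ℝ) (P : JInf n m) : ℝ :=
  lineDeriv ℝ F P (W i P)

/-- scaling on infinite jets -/
def chi (t : ℝ) (P : JInf n m) : JInf n m := (P.1, fun q => t * P.2 q)

/-- scaling on jets -/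
def chiJ {r : ℕ} (t : ℝ) (p : Jet n m r) : Jet n m r := (p.1, fun q => t * p.2 q)

/-- `f` represents `F` over `U`. -/
def Rep (U : Set (Fin n → ℝ)) {r : ℕ} (f : Jet n m r → ℝ) (F : JInf n m → ℝ) : Prop :=
  ContDiffOn ℝ (⊤:ℕ∞) f (Cyl n m r U) ∧ ∀ P : JInf n m, P.1 ∈ U → F P = f (trunc r P)

/-- smooth finite order function over `U` -/
def Sm (U : Set (Fin n → ℝ)) (F : JInf n m → ℝ) : Prop :=
  ∃ (r : ℕ) (f : Jet n m r → ℝ), Rep U f F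

variable {U : Set (Fin n → ℝ)}

theorem Rep.hasLineDerivAt (hU : IsOpen U) {r : ℕ} {f : Jet n m r → ℝ} {F : JInf n m → ℝ}
    (h : Rep U f F) {P : JInf n m} (hP : P.1 ∈ U) (V : JInf n m) :
    HasLineDerivAt ℝ F (fderiv ℝ f (trunc r P) (trunc r V)) P V := by
  have hd : HasFDerivAt f (fderiv ℝ f (trunc r P)) (trunc r P) :=
    ((h.1.differentiableOn (by simp)).differentiableAt
      ((isOpen_Cyl hU).mem_nhds hP)).hasFDerivAt
  have h1 := hd.hasLineDerivAt (trunc r V)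
  unfold HasLineDerivAt at h1 ⊢
  refine h1.congr_of_eventuallyEq ?_
  have hc : ContinuousAt (fun t : ℝ => P.1 + t • V.1) 0 := by fun_prop
  have : ∀ᶠ t : ℝ in 𝓝 0, P.1 + t • V.1 ∈ U :=
    hc.eventually_mem (hU.mem_nhds (by simpa using hP))
  filter_upwards [this] with t ht
  rw [h.2 _ (by simpa using ht)]
  rfl

theorem Rep.TD_eq (hU : IsOpen U) {r : ℕ} {f : Jet n m r → ℝ} {F : JInf n m → ℝ}
    (h : Rep U f F) {P : JInf n m} (hP : P.1 ∈ U) (i : Fin n) :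
    TD i F P = fderiv ℝ f (trunc r P) (trunc r (W i P)) :=
  (h.hasLineDerivAt hU hP _).lineDeriv

theorem formalD_eq (i : Fin n) {r : ℕ} (f : Jet n m r → ℝ) (p : Jet n m (r+1)) :
    formalD i f p = fderiv ℝ f (projJet (Nat.le_succ r) p)
      (Pi.single i 1, fun q => yc q.1 (addE q.2.1 i) p) := by
  classical
  set L := fderiv ℝ f (projJet (Nat.le_succ r) p) with hL
  have h1 : ((Pi.single i 1, fun q => yc q.1 (addE q.2.1 i) p) : Jet n m r)
      = (Pi.single i 1, 0) + ∑ q : JIdx n m r, yc q.1 (addE q.2.1 i) p •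
        ((0, Pi.single q 1) : Jet n m r) := by
    refine Prod.ext ?_ ?_
    · simp [Prod.fst_sum]
    · funext q
      simp [Prod.snd_sum, Finset.sum_apply, Pi.single_apply]
  rw [h1, map_add, map_sum]
  unfold formalD pdX
  rw [← hL]
  congr 1
  refine Finset.sum_congr rfl fun q _ => ?_
  rw [map_smul, smul_eq_mul, pdY, dif_pos q.2.2]

theorem contDiff_yc (σ : Fin m) (J : Fin n → ℕ) {r : ℕ} :
    ContDiff ℝ (⊤:ℕ∞) (yc σ J : Jet n m r → ℝ) := by
  unfold yc
  by_cases h : (∑ i, J i) ≤ r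
  · simp only [h, dite_true]; fun_prop
  · simp only [h, dite_false]; fun_prop

theorem contDiff_projJet {r s : ℕ} (h : r ≤ s) :
    ContDiff ℝ (⊤:ℕ∞) (projJet h : Jet n m s → Jet n m r) := by
  unfold projJet; fun_prop

theorem formalD_contDiffOn (hU : IsOpen U) (i : Fin n) {r : ℕ} {f : Jet n m r → ℝ}
    (hf : ContDiffOn ℝ (⊤:ℕ∞) f (Cyl n m r U)) :
    ContDiffOn ℝ (⊤:ℕ∞) (formalD i f) (Cyl n m (r+1) U) := by
  have h1 : ContDiffOn ℝ (⊤:ℕ∞) (fderiv ℝ f) (Cyl n m r U) :=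
    hf.fderiv_of_isOpen (isOpen_Cyl hU) (by simp)
  have h2 : ContDiffOn ℝ (⊤:ℕ∞) (fun p : Jet n m (r+1) => fderiv ℝ f (projJet (Nat.le_succ r) p))
      (Cyl n m (r+1) U) := h1.comp (contDiff_projJet _).contDiffOn (fun p hp => hp)
  have h3 : ContDiff ℝ (⊤:ℕ∞) (fun p : Jet n m (r+1) =>
      ((Pi.single i 1, fun q => yc q.1 (addE q.2.1 i) p) : Jet n m r)) :=
    contDiff_const.prodMk (contDiff_pi.2 fun q => contDiff_yc _ _)
  have : formalD i f = fun p => fderiv ℝ f (projJet (Nat.le_succ r) p)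
      (Pi.single i 1, fun q => yc q.1 (addE q.2.1 i) p) := funext fun p => formalD_eq i f p
  rw [this]
  exact h2.clm_apply h3.contDiffOn

theorem sum_addE (J : Fin n → ℕ) (i : Fin n) : ∑ k, addE J i k = (∑ k, J k) + 1 := by
  simp [addE, Finset.sum_add_distrib]

theorem yc_trunc (σ : Fin m) (J : Fin n → ℕ) {r : ℕ} (h : ∑ i, J i ≤ r) (P : JInf n m) :
    yc σ J (trunc r P) = P.2 (σ, J) := by
  rw [yc, dif_pos h]; rfl

theorem Rep.formalD (hU : IsOpen U) {r : ℕ} {f : Jet n m r → ℝ} {F : JInf n m → ℝ}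
    (h : Rep U f F) (i : Fin n) : Rep U (formalD i f) (TD i F) := by
  refine ⟨formalD_contDiffOn hU i h.1, fun P hP => ?_⟩
  rw [h.TD_eq hU hP, formalD_eq]
  congr 1
  refine Prod.ext rfl (funext fun q => ?_)
  dsimp only
  rw [yc_trunc _ _ (by rw [sum_addE]; have := q.2.2; omega)]
  rfl

theorem Sm.TD (hU : IsOpen U) {F : JInf n m → ℝ} (h : Sm U F) (i : Fin n) : Sm U (TD i F) := by
  obtain ⟨r, f, h⟩ := h
  exact ⟨_, _, h.formalD hU i⟩

/-- iterated total derivative along a list -/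
noncomputable def TDL : List (Fin n) → (JInf n m → ℝ) → (JInf n m → ℝ)
  | [], F => F
  | i :: l, F => TD i (TDL l F)

theorem Rep.formalDL (hU : IsOpen U) {r : ℕ} {f : Jet n m r → ℝ} {F : JInf n m → ℝ}
    (h : Rep U f F) (l : List (Fin n)) : Rep U (formalDL l f) (TDL l F) := by
  induction l with
  | nil => exact h
  | cons i l ih => exact ih.formalD hU i

theorem Sm.TDL (hU : IsOpen U) {F : JInf n m → ℝ} (h : Sm U F) (l : List (Fin n)) :
    Sm U (TDL l F) := by
  obtain ⟨r, f, h⟩ := h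
  exact ⟨_, _, h.formalDL hU l⟩

/-- `d_J` -/
noncomputable def dJ (J : Fin n → ℕ) : (JInf n m → ℝ) → (JInf n m → ℝ) := TDL (mlist J)

theorem Rep.formalDI (hU : IsOpen U) {r : ℕ} {f : Jet n m r → ℝ} {F : JInf n m → ℝ}
    (h : Rep U f F) (J : Fin n → ℕ) {P : JInf n m} (hP : P.1 ∈ U) :
    formalDI J f (trunc _ P) = dJ J F P :=
  ((h.formalDL hU (mlist J)).2 P hP).symm

theorem Sm.congr {F G : JInf n m → ℝ} (h : Sm U F) (hFG : ∀ P : JInf n m, P.1 ∈ U → G P = F P) :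
    Sm U G := by
  obtain ⟨r, f, h⟩ := h
  exact ⟨r, f, h.1, fun P hP => (hFG P hP).trans (h.2 P hP)⟩

theorem TD_congr (hU : IsOpen U) {F G : JInf n m → ℝ}
    (hFG : ∀ P : JInf n m, P.1 ∈ U → F P = G P) (i : Fin n) {P : JInf n m} (hP : P.1 ∈ U) :
    TD i F P = TD i G P := by
  unfold JetVar.TD lineDeriv
  refine Filter.EventuallyEq.deriv_eq ?_
  have hc : ContinuousAt (fun t : ℝ => P.1 + t • (W i P).1) 0 := by fun_prop
  have : ∀ᶠ t : ℝ in 𝓝 0, P.1 + t • (W i P).1 ∈ U :=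
    hc.eventually_mem (hU.mem_nhds (by simpa using hP))
  filter_upwards [this] with t ht
  exact hFG _ ht

theorem TDL_congr (hU : IsOpen U) {F G : JInf n m → ℝ}
    (hFG : ∀ P : JInf n m, P.1 ∈ U → F P = G P) (l : List (Fin n)) :
    ∀ {P : JInf n m}, P.1 ∈ U → TDL l F P = TDL l G P := by
  induction l with
  | nil => exact fun hP => hFG _ hP
  | cons i l ih => exact fun hP => TD_congr hU (fun P hP => ih hP) i hP

theorem Rep.lift {r s : ℕ} {f : Jet n m r → ℝ} {F : JInf n m → ℝ}
    (h : Rep U f F) (hrs : r ≤ s) : Rep U (fun p : Jet n m s => f (projJet hrs p)) F :=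
  ⟨h.1.comp (contDiff_projJet _).contDiffOn (fun _ hp => hp), fun P hP => h.2 P hP⟩

theorem Sm.two {F G : JInf n m → ℝ} (hF : Sm U F) (hG : Sm U G) :
    ∃ (r : ℕ) (f g : Jet n m r → ℝ), Rep U f F ∧ Rep U g G := by
  obtain ⟨r, f, hf⟩ := hF
  obtain ⟨s, g, hg⟩ := hG
  exact ⟨max r s, _, _, hf.lift (le_max_left r s), hg.lift (le_max_right r s)⟩

theorem Sm.mul {F G : JInf n m → ℝ} (hF : Sm U F) (hG : Sm U G) :
    Sm U (fun P => F P * G P) := by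
  obtain ⟨r, f, g, hf, hg⟩ := hF.two hG
  exact ⟨r, fun p => f p * g p, hf.1.mul hg.1, fun P hP => by
    simp only [hf.2 P hP, hg.2 P hP]⟩

theorem Sm.add {F G : JInf n m → ℝ} (hF : Sm U F) (hG : Sm U G) :
    Sm U (fun P => F P + G P) := by
  obtain ⟨r, f, g, hf, hg⟩ := hF.two hG
  exact ⟨r, fun p => f p + g p, hf.1.add hg.1, fun P hP => by
    simp only [hf.2 P hP, hg.2 P hP]⟩

theorem Sm.const (c : ℝ) : Sm U (fun _ : JInf n m => c) :=
  ⟨0, fun _ => c, contDiffOn_const, fun _ _ => rfl⟩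

theorem Sm.sum {ι : Type*} (s : Finset ι) {F : ι → JInf n m → ℝ} (hF : ∀ a ∈ s, Sm U (F a)) :
    Sm U (fun P => ∑ a ∈ s, F a P) := by
  classical
  induction s using Finset.induction_on with
  | empty => simpa using Sm.const 0
  | insert a s ha ih =>
    simp only [Finset.sum_insert ha]
    exact (hF a (Finset.mem_insert_self _ _)).add
      (ih fun b hb => hF b (Finset.mem_insert_of_mem hb))

theorem Sm.coord (σ : Fin m) (J : Fin n → ℕ) : Sm U (fun P : JInf n m => P.2 (σ, J)) :=
  ⟨∑ i, J i, yc σ J, (contDiff_yc σ J).contDiffOn, fun P _ => (yc_trunc σ J le_rfl P).symm⟩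

theorem Sm.hasTD (hU : IsOpen U) {F : JInf n m → ℝ} (hF : Sm U F) (i : Fin n)
    {P : JInf n m} (hP : P.1 ∈ U) :
    HasDerivAt (fun t : ℝ => F (P + t • W i P)) (JetVar.TD i F P) 0 := by
  obtain ⟨r, f, h⟩ := hF
  rw [h.TD_eq hU hP]
  exact h.hasLineDerivAt hU hP _

theorem TD_mul (hU : IsOpen U) {F G : JInf n m → ℝ} (hF : Sm U F) (hG : Sm U G) (i : Fin n)
    {P : JInf n m} (hP : P.1 ∈ U) :
    TD i (fun P => F P * G P) P = TD i F P * G P + F P * TD i G P := by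
  have := ((hF.hasTD hU i hP).fun_mul (hG.hasTD hU i hP)).deriv
  simp only [zero_smul, add_zero] at this
  exact this

theorem TD_const_mul (c : ℝ) (F : JInf n m → ℝ) (i : Fin n) (P : JInf n m) :
    TD i (fun P => c * F P) P = c * TD i F P := by
  unfold JetVar.TD lineDeriv
  rw [deriv_const_mul_field]

theorem TD_sum (hU : IsOpen U) {ι : Type*} (s : Finset ι) {F : ι → JInf n m → ℝ}
    (hF : ∀ a ∈ s, Sm U (F a)) (i : Fin n)
    {P : JInf n m} (hP : P.1 ∈ U) :
    TD i (fun P => ∑ a ∈ s, F a P) P = ∑ a ∈ s, TD i (F a) P := by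
  exact (HasDerivAt.fun_sum fun a ha => (hF a ha).hasTD hU i hP).deriv

theorem TD_coord (σ : Fin m) (J : Fin n → ℕ) (i : Fin n) (P : JInf n m) :
    TD i (fun P : JInf n m => P.2 (σ, J)) P = P.2 (σ, addE J i) := by
  unfold JetVar.TD lineDeriv W
  simp

theorem TDL_sum (hU : IsOpen U) {ι : Type*} (s : Finset ι) {F : ι → JInf n m → ℝ}
    (hF : ∀ a ∈ s, Sm U (F a)) (l : List (Fin n)) :
    ∀ {P : JInf n m}, P.1 ∈ U → TDL l (fun P => ∑ a ∈ s, F a P) P = ∑ a ∈ s, TDL l (F a) P := by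
  induction l with
  | nil => exact fun hP => rfl
  | cons i l ih =>
    intro P hP
    simp only [JetVar.TDL]
    rw [TD_congr hU (fun P hP => ih hP) i hP, TD_sum hU s (fun a ha => (hF a ha).TDL hU l) i hP]

theorem TDL_add (hU : IsOpen U) {F G : JInf n m → ℝ} (hF : Sm U F) (hG : Sm U G)
    (l : List (Fin n)) {P : JInf n m} (hP : P.1 ∈ U) :
    TDL l (fun P => F P + G P) P = TDL l F P + TDL l G P := by
  have := TDL_sum hU (Finset.univ : Finset Bool) (F := fun b => if b then F else G)
    (by rintro (_ | _) _ <;> simpa) l hP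
  simpa using this

theorem TDL_zero (hU : IsOpen U) (l : List (Fin n)) {P : JInf n m} (hP : P.1 ∈ U) :
    TDL l (fun _ => 0) P = 0 := by
  have := TDL_sum hU (∅ : Finset Bool) (F := fun _ _ => 0) (by simp) l hP
  simpa using this

end Inf
section Scaling
open Set Filter Topology MeasureTheory
variable {U : Set (Fin n → ℝ)}

/-- scaling as a continuous linear map -/
noncomputable def chiL {r : ℕ} (t : ℝ) : Jet n m r →L[ℝ] Jet n m r :=
  (ContinuousLinearMap.fst ℝ _ _).prod (t • ContinuousLinearMap.snd ℝ _ _)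

theorem chiL_apply {r : ℕ} (t : ℝ) (p : Jet n m r) : chiL t p = chiJ t p := rfl

theorem scale_contDiffOn {r : ℕ} {h : Jet n m r → ℝ}
    (hh : ContDiffOn ℝ (⊤:ℕ∞) h (Cyl n m r U)) {φ : ℝ → ℝ} (hφ : ContDiff ℝ (⊤:ℕ∞) φ) :
    ContDiffOn ℝ (⊤:ℕ∞) (fun z : ℝ × Jet n m r => φ z.1 * h (chiJ z.1 z.2))
      (univ ×ˢ Cyl n m r U) := by
  refine ContDiffOn.mul (hφ.comp contDiff_fst).contDiffOn ?_
  refine hh.comp (t := Cyl n m r U) (f := fun z : ℝ × Jet n m r => chiJ z.1 z.2) ?_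
    (fun z hz => hz.2)
  apply ContDiff.contDiffOn
  unfold chiJ
  fun_prop

theorem scale_fderiv (hU : IsOpen U) {r : ℕ} {h : Jet n m r → ℝ}
    (hh : ContDiffOn ℝ (⊤:ℕ∞) h (Cyl n m r U)) {φ : ℝ → ℝ} (hφ : ContDiff ℝ (⊤:ℕ∞) φ)
    {p : Jet n m r} (hp : p ∈ Cyl n m r U) (v : Jet n m r) :
    fderiv ℝ (fun p => ∫ t in (0:ℝ)..1, φ t * h (chiJ t p)) p v
      = ∫ t in (0:ℝ)..1, φ t * fderiv ℝ h (chiJ t p) (chiJ t v) := by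
  have hf := scale_contDiffOn hh hφ
  have hD := isOpen_Cyl (m := m) (r := r) hU
  have hO : IsOpen ((univ : Set ℝ) ×ˢ Cyl n m r U) := isOpen_univ.prod hD
  have h1 := (pint_hasFDerivAt hD hf hp).fderiv
  dsimp only at h1
  rw [h1]
  have hf' : ContinuousOn (fderiv ℝ (fun z : ℝ × Jet n m r => φ z.1 * h (chiJ z.1 z.2)))
      (univ ×ˢ Cyl n m r U) :=
    hf.continuousOn_fderiv_of_isOpen hO (by simp)
  have hcg : Continuous (fun t : ℝ => (fderiv ℝ
      (fun z : ℝ × Jet n m r => φ z.1 * h (chiJ z.1 z.2)) (t, p)).comp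
      (ContinuousLinearMap.inr ℝ ℝ (Jet n m r))) :=
    (hf'.comp_continuous (f := fun t : ℝ => (t, p)) (by fun_prop)
      (fun t => ⟨mem_univ _, hp⟩)).clm_comp continuous_const
  rw [ContinuousLinearMap.intervalIntegral_apply (hcg.intervalIntegrable _ _)]
  refine intervalIntegral.integral_congr fun t _ => ?_
  have e1 : HasFDerivAt (fun p => φ t * h (chiJ t p)) ((fderiv ℝ
      (fun z : ℝ × Jet n m r => φ z.1 * h (chiJ z.1 z.2)) (t, p)).comp
      (ContinuousLinearMap.inr ℝ ℝ (Jet n m r))) p :=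
    ((hf.differentiableOn (by simp)).differentiableAt
      (hO.mem_nhds ⟨mem_univ t, hp⟩)).hasFDerivAt.comp p (hasFDerivAt_prodMk_right t p)
  have e2 : HasFDerivAt h (fderiv ℝ h (chiL t p)) (chiL t p) :=
    ((hh.differentiableOn (by simp)).differentiableAt
      (hD.mem_nhds (show chiL t p ∈ Cyl n m r U from hp))).hasFDerivAt
  have e3 := (e2.comp p (chiL t).hasFDerivAt).const_mul (φ t)
  rw [e1.unique e3]
  rfl

theorem scale_int_contDiffOn (hU : IsOpen U) {r : ℕ} {h : Jet n m r → ℝ}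
    (hh : ContDiffOn ℝ (⊤:ℕ∞) h (Cyl n m r U)) {φ : ℝ → ℝ} (hφ : ContDiff ℝ (⊤:ℕ∞) φ) :
    ContDiffOn ℝ (⊤:ℕ∞) (fun p => ∫ t in (0:ℝ)..1, φ t * h (chiJ t p)) (Cyl n m r U) :=
  pint_contDiffOn (isOpen_Cyl hU) (scale_contDiffOn hh hφ)

/-- weighted radial integral -/
noncomputable def RI (H : JInf n m → ℝ) (P : JInf n m) : ℝ := ∫ t in (0:ℝ)..1, t * H (chi t P)

theorem Rep.RI (hU : IsOpen U) {r : ℕ} {h : Jet n m r → ℝ} {H : JInf n m → ℝ}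
    (hh : Rep U h H) : Rep U (fun p => ∫ t in (0:ℝ)..1, t * h (chiJ t p)) (RI H) := by
  refine ⟨scale_int_contDiffOn hU hh.1 contDiff_id, fun P hP => ?_⟩
  refine intervalIntegral.integral_congr fun t _ => ?_
  rw [hh.2 (chi t P) hP]
  rfl

theorem Sm.RI (hU : IsOpen U) {H : JInf n m → ℝ} (hH : Sm U H) : Sm U (RI H) := by
  obtain ⟨r, h, hh⟩ := hH
  exact ⟨_, _, hh.RI hU⟩

theorem TD_RI (hU : IsOpen U) {H : JInf n m → ℝ} (hH : Sm U H) (i : Fin n)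
    {P : JInf n m} (hP : P.1 ∈ U) : TD i (RI H) P = RI (TD i H) P := by
  obtain ⟨r, h, hh⟩ := hH
  rw [(hh.RI hU).TD_eq hU hP]
  have := scale_fderiv hU hh.1 (contDiff_id) (p := trunc r P) hP (trunc r (W i P))
  simp only [id] at this
  rw [this]
  refine intervalIntegral.integral_congr fun t _ => ?_
  rw [hh.TD_eq hU (P := chi t P) hP]
  rfl

theorem TDL_RI (hU : IsOpen U) {H : JInf n m → ℝ} (hH : Sm U H) (l : List (Fin n)) :
    ∀ {P : JInf n m}, P.1 ∈ U → TDL l (RI H) P = RI (TDL l H) P := by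
  induction l with
  | nil => exact fun _ => rfl
  | cons i l ih =>
    intro P hP
    simp only [JetVar.TDL]
    rw [TD_congr hU (fun P hP => ih hP) i hP, TD_RI hU (hH.TDL hU l) i hP]

end Scaling

section Comb

theorem mlist_zero : mlist (fun _ : Fin n => 0) = [] := by
  simp [mlist]

theorem mlist_addE (J : Fin n → ℕ) (i : Fin n) (h : ∀ k, k < i → J k = 0) :
    mlist (addE J i) = i :: mlist J := by
  have key : ∀ l : List (Fin n), l.Pairwise (· < ·) → i ∈ l →
      l.flatMap (fun k => List.replicate (addE J i k) k)
        = i :: l.flatMap (fun k => List.replicate (J k) k) := by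
    intro l
    induction l with
    | nil => simp
    | cons a l ih =>
      intro hp hi
      rw [List.pairwise_cons] at hp
      rw [List.flatMap_cons, List.flatMap_cons]
      by_cases hai : a = i
      · subst hai
        have h2 : l.flatMap (fun k => List.replicate (addE J a k) k)
            = l.flatMap (fun k => List.replicate (J k) k) := by
          refine List.flatMap_congr fun k hk => ?_
          have := (hp.1 k hk).ne'
          simp [addE, this]
        rw [h2]
        simp [addE, List.replicate_succ]
      · have hil : i ∈ l := by
          rcases List.mem_cons.1 hi with h | h
          · exact absurd h.symm hai
          · exact h
        rw [ih hp.2 hil]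
        have h0 := h a (hp.1 i hil)
        simp [addE, hai, h0]
  exact key _ (List.pairwise_lt_finRange n) (List.mem_finRange i)

theorem multi_induction {p : (Fin n → ℕ) → Prop} (h0 : p (fun _ => 0))
    (hs : ∀ J i, (∀ k, k < i → J k = 0) → p J → p (addE J i)) : ∀ J, p J := by
  have : ∀ N (J : Fin n → ℕ), ∑ i, J i = N → p J := by
    intro N
    induction N with
    | zero =>
      intro J hJ
      have : J = fun _ => 0 := by
        funext i
        exact (Finset.sum_eq_zero_iff.1 hJ) i (Finset.mem_univ i)
      rw [this]; exact h0
    | succ N ih =>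
      intro J hJ
      have hne : (Finset.univ.filter fun i => J i ≠ 0).Nonempty := by
        by_contra hcon
        rw [Finset.not_nonempty_iff_eq_empty, Finset.filter_eq_empty_iff] at hcon
        have : ∑ i, J i = 0 := Finset.sum_eq_zero fun i hi => by simpa using hcon hi
        omega
      set i := (Finset.univ.filter fun i => J i ≠ 0).min' hne with hi
      have hi1 : J i ≠ 0 := by
        have := Finset.min'_mem _ hne
        rw [← hi] at this
        simpa using this
      have hi2 : ∀ k, k < i → J k = 0 := by
        intro k hk
        by_contra hk0
        have := Finset.min'_le (Finset.univ.filter fun i => J i ≠ 0) k (by simpa using hk0)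
        rw [← hi] at this
        exact absurd hk (not_lt.2 this)
      have hJe : addE (subE J i) i = J := by
        funext k
        by_cases hk : k = i
        · subst hk; simp [addE, subE]; omega
        · simp [addE, subE, hk]
      rw [← hJe]
      refine hs _ i ?_ (ih _ ?_)
      · intro k hk
        simp [subE, hi2 k hk]
      · have := sum_addE (subE J i) i
        rw [hJe] at this
        omega
  exact fun J => this _ J rfl

/-- multi-binomial -/
def mch (J I : Fin n → ℕ) : ℝ := ∏ i, (Nat.choose (J i) (I i) : ℝ)

theorem mch_eq_zero {J I : Fin n → ℕ} (h : ¬ I ≤ J) : mch J I = 0 := by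
  rw [Pi.le_def] at h
  push Not at h
  obtain ⟨i, hi⟩ := h
  exact Finset.prod_eq_zero (Finset.mem_univ i) (by simp [Nat.choose_eq_zero_of_lt hi])

theorem mch_addE (J I : Fin n → ℕ) (i : Fin n) :
    mch (addE J i) I = mch J I + (if I i ≠ 0 then mch J (subE I i) else 0) := by
  unfold mch
  have e : ∀ f : Fin n → ℝ, ∏ k, f k = f i * ∏ k ∈ Finset.univ.erase i, f k := fun f =>
    (Finset.mul_prod_erase _ _ (Finset.mem_univ i)).symm
  rw [e, e (fun k => ((J k).choose (I k) : ℝ)), e (fun k => ((J k).choose (subE I i k) : ℝ))]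
  have c1 : ∏ k ∈ Finset.univ.erase i, ((addE J i k).choose (I k) : ℝ)
      = ∏ k ∈ Finset.univ.erase i, ((J k).choose (I k) : ℝ) :=
    Finset.prod_congr rfl fun k hk => by simp [addE, Finset.ne_of_mem_erase hk]
  have c2 : ∏ k ∈ Finset.univ.erase i, ((J k).choose (subE I i k) : ℝ)
      = ∏ k ∈ Finset.univ.erase i, ((J k).choose (I k) : ℝ) :=
    Finset.prod_congr rfl fun k hk => by simp [subE, Finset.ne_of_mem_erase hk]
  rw [c1, c2]
  rcases hI : I i with _ | a
  · simp [addE]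
  · simp [addE, subE, hI, Nat.choose_succ_succ]
    ring

theorem pascal_sum (J : Fin n → ℕ) (i : Fin n) (a : (Fin n → ℕ) → (Fin n → ℕ) → ℝ) :
    ∑ I ∈ Finset.Iic (addE J i), mch (addE J i) I * a I (addE J i - I)
      = ∑ I ∈ Finset.Iic J, mch J I * (a (addE I i) (J - I) + a I (addE (J - I) i)) := by
  have h1 : ∑ I ∈ Finset.Iic (addE J i), mch J I * a I (addE J i - I)
      = ∑ I ∈ Finset.Iic J, mch J I * a I (addE (J - I) i) := by
    have hsub : Finset.Iic J ⊆ Finset.Iic (addE J i) := by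
      intro I hI
      rw [Finset.mem_Iic, Pi.le_def] at hI ⊢
      intro k; have := hI k; simp only [addE]; omega
    rw [← Finset.sum_subset hsub]
    · refine Finset.sum_congr rfl fun I hI => ?_
      rw [Finset.mem_Iic, Pi.le_def] at hI
      congr 2
      funext k
      have := hI k
      simp only [addE, Pi.sub_apply]; omega
    · intro I _ hI
      rw [mch_eq_zero (by simpa using hI), zero_mul]
  have h2 : ∑ I ∈ Finset.Iic (addE J i),
        (if I i ≠ 0 then mch J (subE I i) else 0) * a I (addE J i - I)
      = ∑ I ∈ Finset.Iic J, mch J I * a (addE I i) (J - I) := by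
    simp only [ite_mul, zero_mul]
    rw [← Finset.sum_filter]
    refine Finset.sum_bij' (fun I _ => subE I i) (fun I _ => addE I i) ?_ ?_ ?_ ?_ ?_
    · intro I hI
      simp only [Finset.mem_filter, Finset.mem_Iic, Pi.le_def] at hI ⊢
      intro k; have := hI.1 k; simp only [addE, subE] at *; omega
    · intro I hI
      simp only [Finset.mem_filter, Finset.mem_Iic, Pi.le_def] at hI ⊢
      refine ⟨fun k => ?_, by simp [addE]⟩
      have := hI k; simp only [addE]; omega
    · intro I hI
      simp only [Finset.mem_filter] at hI
      funext k
      by_cases hk : k = i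
      · subst hk; simp only [addE, subE, if_true]; have := hI.2; omega
      · simp [addE, subE, hk]
    · intro I hI
      funext k
      simp [addE, subE]
    · intro I hI
      simp only [Finset.mem_filter] at hI
      have e : addE (subE I i) i = I := by
        funext k
        by_cases hk : k = i
        · subst hk; simp only [addE, subE, if_true]; have := hI.2; omega
        · simp [addE, subE, hk]
      rw [e]
      congr 2
      funext k
      by_cases hk : k = i
      · subst hk; simp only [addE, subE, if_true, Pi.sub_apply]; have := hI.2; omega
      · simp [addE, subE, hk]
  simp only [mch_addE, add_mul, mul_add, Finset.sum_add_distrib]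
  rw [h1, h2]
  ring

theorem dJ_addE (J : Fin n → ℕ) (i : Fin n) (h : ∀ k, k < i → J k = 0) (F : JInf n m → ℝ) :
    dJ (addE J i) F = TD i (dJ J F) := by
  unfold dJ
  rw [mlist_addE J i h]
  rfl

theorem leibniz {U : Set (Fin n → ℝ)} (hU : IsOpen U) {G : JInf n m → ℝ} (hG : Sm U G)
    (ν : Fin m) (J : Fin n → ℕ) : ∀ {P : JInf n m}, P.1 ∈ U →
    dJ J (fun P => P.2 (ν, fun _ => 0) * G P) P
      = ∑ I ∈ Finset.Iic J, mch J I * (P.2 (ν, I) * dJ (J - I) G P) := by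
  induction J using multi_induction with
  | h0 =>
    intro P hP
    have : Finset.Iic (fun _ : Fin n => 0) = {fun _ => 0} := by
      ext I
      simp only [Finset.mem_Iic, Finset.mem_singleton, Pi.le_def, funext_iff]
      simp
    rw [this, Finset.sum_singleton]
    have e : ((fun _ => 0) - (fun _ => 0) : Fin n → ℕ) = fun _ => 0 := by funext k; simp
    rw [e]
    simp [dJ, mlist_zero, TDL, mch]
  | hs J i hi ih =>
    intro P hP
    rw [dJ_addE J i hi, TD_congr hU (fun P hP => ih hP) i hP, TD_sum hU _ _ i hP,
      pascal_sum J i (fun I K => P.2 (ν, I) * dJ K G P)]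
    · refine Finset.sum_congr rfl fun I hI => ?_
      rw [TD_const_mul, TD_mul hU (Sm.coord ν I) (G := dJ (J - I) G) (hG.TDL hU _) i hP, TD_coord,
        dJ_addE (J - I) i (fun k hk => by simp [hi k hk])]
    · intro I hI
      exact (Sm.const _).mul ((Sm.coord ν I).mul (hG.TDL hU _))

theorem reorg (s : ℕ) (a : (Fin n → ℕ) → (Fin n → ℕ) → ℝ) :
    ∑ J : MD n s, ∑ I ∈ Finset.Iic J.1, a I (J.1 - I)
      = ∑ I : MD n s, ∑ K : MD n s, if (∑ i, (I.1 i + K.1 i)) ≤ s then a I.1 K.1 else 0 := by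
  rw [Finset.sum_sigma', ← Finset.sum_product', ← Finset.sum_filter]
  have hle : ∀ {A B : Fin n → ℕ}, A ≤ B → ∑ i, A i ≤ ∑ i, B i := fun h =>
    Finset.sum_le_sum fun i _ => h i
  refine Finset.sum_bij'
    (fun x hx => ((⟨x.2, by
        simp only [Finset.mem_sigma, Finset.mem_Iic] at hx
        exact (hle hx.2).trans x.1.2⟩, ⟨x.1.1 - x.2, (hle (fun i => Nat.sub_le _ _)).trans x.1.2⟩) :
        MD n s × MD n s))
    (fun y hy => ⟨⟨y.1.1 + y.2.1, by
        simp only [Finset.mem_filter] at hy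
        exact hy.2⟩, y.1.1⟩) ?_ ?_ ?_ ?_ ?_
  · rintro ⟨J, I⟩ hx
    simp only [Finset.mem_sigma, Finset.mem_Iic, Pi.le_def] at hx
    simp only [Finset.mem_filter, Finset.mem_product, Finset.mem_univ, true_and, Pi.sub_apply]
    refine le_trans (le_of_eq (Finset.sum_congr rfl fun i _ => ?_)) J.2
    have := hx.2 i
    omega
  · rintro ⟨I, K⟩ hy
    simp only [Finset.mem_sigma, Finset.mem_Iic, Finset.mem_univ, true_and]
    exact fun i => Nat.le_add_right _ _
  · rintro ⟨J, I⟩ hx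
    simp only [Finset.mem_sigma, Finset.mem_Iic] at hx
    have e : I + (J.1 - I) = J.1 := by
      funext i; have : I i ≤ J.1 i := hx.2 i; simp only [Pi.add_apply, Pi.sub_apply]; omega
    simp [e]
  · rintro ⟨I, K⟩ hy
    simp
  · rintro ⟨J, I⟩ hx
    rfl

end Comb
section Final
open Set Filter Topology MeasureTheory
variable {U : Set (Fin n → ℝ)}

theorem pdY_contDiffOn (hU : IsOpen U) (σ : Fin m) (J : Fin n → ℕ) {r : ℕ} {f : Jet n m r → ℝ}
    (hf : ContDiffOn ℝ (⊤:ℕ∞) f (Cyl n m r U)) :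
    ContDiffOn ℝ (⊤:ℕ∞) (pdY σ J f) (Cyl n m r U) := by
  have h1 : ContDiffOn ℝ (⊤:ℕ∞) (fderiv ℝ f) (Cyl n m r U) :=
    hf.fderiv_of_isOpen (isOpen_Cyl hU) (by simp)
  unfold pdY
  by_cases h : (∑ i, J i) ≤ r
  · simp only [h, dite_true]
    exact h1.clm_apply contDiffOn_const
  · simp only [h, dite_false]
    exact contDiffOn_const

theorem Rep.of {r : ℕ} {f : Jet n m r → ℝ} (hf : ContDiffOn ℝ (⊤:ℕ∞) f (Cyl n m r U)) :
    Rep U f (fun P => f (trunc r P)) := ⟨hf, fun _ _ => rfl⟩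

theorem LieEuler_eq (hU : IsOpen U) {r : ℕ} (σ : Fin m) (I : Fin n → ℕ) {L : Jet n m r → ℝ}
    (hL : ContDiffOn ℝ (⊤:ℕ∞) L (Cyl n m r U)) {P : JInf n m} (hP : P.1 ∈ U) :
    LieEuler σ I L (trunc (2*r) P) = ∑ J : MD n r, if (∑ i, (I i + J.1 i)) ≤ r then
      (-1:ℝ)^(∑ i, J.1 i) * mch (fun i => I i + J.1 i) I *
        dJ J.1 (fun P => pdY σ (fun i => I i + J.1 i) L (trunc r P)) P else 0 := by
  unfold LieEuler
  refine Finset.sum_congr rfl fun J _ => ?_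
  rw [dite_eq_ite]
  refine if_congr Iff.rfl ?_ rfl
  rw [← (Rep.of (pdY_contDiffOn hU σ _ hL)).formalDI hU J.1 hP]
  rfl

theorem TV_contDiffOn (hU : IsOpen U) {s : ℕ} {T : Fin m → Jet n m s → ℝ}
    (hT : ∀ σ, ContDiffOn ℝ (⊤:ℕ∞) (T σ) (Cyl n m s U)) (σ : Fin m) :
    ContDiffOn ℝ (⊤:ℕ∞) (fun p => ∫ t in (0:ℝ)..1, T σ (chiJ t p)) (Cyl n m s U) := by
  simpa using scale_int_contDiffOn hU (hT σ) (φ := fun _ => 1) contDiff_const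

theorem TontiVainberg_contDiffOn (hU : IsOpen U) {s : ℕ} {T : Fin m → Jet n m s → ℝ}
    (hT : ∀ σ, ContDiffOn ℝ (⊤:ℕ∞) (T σ) (Cyl n m s U)) :
    ContDiffOn ℝ (⊤:ℕ∞) (TontiVainberg T) (Cyl n m s U) := by
  unfold TontiVainberg
  exact ContDiffOn.sum fun σ _ => (contDiff_yc σ _).contDiffOn.mul (TV_contDiffOn hU hT σ)

theorem fderiv_yc (ν : Fin m) {s : ℕ} (p v : Jet n m s) :
    fderiv ℝ (yc ν (fun _ => 0) : Jet n m s → ℝ) p v = yc ν (fun _ => 0) v := by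
  have h : (∑ i : Fin n, 0) ≤ s := by simp
  have e : (yc ν (fun _ => 0) : Jet n m s → ℝ) = ((ContinuousLinearMap.proj (R := ℝ)
      (φ := fun _ : JIdx n m s => ℝ) (ν, ⟨fun _ => 0, h⟩)).comp
      (ContinuousLinearMap.snd ℝ (Fin n → ℝ) (JIdx n m s → ℝ)) : Jet n m s →L[ℝ] ℝ) := by
    funext q
    rw [yc, dif_pos h]
    rfl
  rw [e, ContinuousLinearMap.fderiv]

theorem pdY_TV (hU : IsOpen U) {s : ℕ} {T : Fin m → Jet n m s → ℝ}
    (hT : ∀ σ, ContDiffOn ℝ (⊤:ℕ∞) (T σ) (Cyl n m s U)) (σ : Fin m) (J : Fin n → ℕ)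
    (hJ : ∑ i, J i ≤ s) {p : Jet n m s} (hp : p ∈ Cyl n m s U) :
    pdY σ J (TontiVainberg T) p =
      (if J = (fun _ => 0) then ∫ t in (0:ℝ)..1, T σ (chiJ t p) else 0) +
      ∑ ν, yc ν (fun _ => 0) p * ∫ t in (0:ℝ)..1, t * pdY σ J (T ν) (chiJ t p) := by
  classical
  have hD := isOpen_Cyl (m := m) (r := s) hU
  have h1 : ∀ ν, HasFDerivAt (fun p => ∫ t in (0:ℝ)..1, T ν (chiJ t p))
      (fderiv ℝ (fun p => ∫ t in (0:ℝ)..1, T ν (chiJ t p)) p) p := fun ν =>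
    (((TV_contDiffOn hU hT ν).differentiableOn (by simp)).differentiableAt
      (hD.mem_nhds hp)).hasFDerivAt
  have h2 : ∀ ν, HasFDerivAt (yc ν (fun _ => 0) : Jet n m s → ℝ)
      (fderiv ℝ (yc ν (fun _ => 0) : Jet n m s → ℝ) p) p := fun ν =>
    ((contDiff_yc ν _).differentiable (by simp) p).hasFDerivAt
  have h3 : HasFDerivAt (TontiVainberg T) _ p :=
    HasFDerivAt.fun_sum (u := Finset.univ) fun ν _ => (h2 ν).fun_mul (h1 ν)
  rw [pdY, dif_pos hJ, h3.fderiv]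
  simp only [sum_apply, add_apply,
    smul_apply, smul_eq_mul, fderiv_yc]
  rw [Finset.sum_add_distrib, add_comm]
  congr 1
  · have h : (∑ i : Fin n, 0) ≤ s := by simp
    simp only [yc, dif_pos h]
    rw [Finset.sum_eq_single σ]
    · by_cases h0 : J = fun _ => 0
      · subst h0; simp; rfl
      · rw [if_neg h0, Pi.single_eq_of_ne, mul_zero]
        intro hc
        simp only [Prod.mk.injEq, Subtype.mk.injEq] at hc
        exact h0 hc.2.symm
    · intro ν _ hν
      rw [Pi.single_eq_of_ne, mul_zero]
      intro hc
      simp only [Prod.mk.injEq] at hc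
      exact hν hc.1
    · simp
  · refine Finset.sum_congr rfl fun ν _ => ?_
    congr 1
    have := scale_fderiv hU (hT ν) (φ := fun _ => 1) contDiff_const hp
      (0, Pi.single (σ, (⟨J, hJ⟩ : MD n s)) 1)
    simp only [one_mul] at this
    rw [this]
    refine intervalIntegral.integral_congr fun t _ => ?_
    simp only [pdY, dif_pos hJ]
    rw [← smul_eq_mul, ← map_smul]
    congr 1
    refine Prod.ext ?_ ?_
    · simp [chiJ]
    · funext q; simp [chiJ]

theorem FTC_T (hU : IsOpen U) {s : ℕ} {f : Jet n m s → ℝ}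
    (hf : ContDiffOn ℝ (⊤:ℕ∞) f (Cyl n m s U)) {p : Jet n m s} (hp : p ∈ Cyl n m s U) :
    (∫ t in (0:ℝ)..1, f (chiJ t p)) + ∑ q : JIdx n m s, p.2 q *
      ∫ t in (0:ℝ)..1, t * pdY q.1 q.2.1 f (chiJ t p) = f p := by
  classical
  have hD := isOpen_Cyl (m := m) (r := s) hU
  have hcont : ∀ g : Jet n m s → ℝ, ContDiffOn ℝ (⊤:ℕ∞) g (Cyl n m s U) →
      Continuous (fun t : ℝ => g (chiJ t p)) := fun g hg =>
    hg.continuousOn.comp_continuous (f := fun t : ℝ => chiJ t p)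
      (by unfold chiJ; fun_prop) (fun t => hp)
  have hc1 := hcont f hf
  have hc2 : ∀ q : JIdx n m s, Continuous (fun t : ℝ => t * pdY q.1 q.2.1 f (chiJ t p)) :=
    fun q => continuous_id.mul (hcont _ (pdY_contDiffOn hU _ _ hf))
  simp only [← intervalIntegral.integral_const_mul]
  rw [← intervalIntegral.integral_finsetSum
    (fun q _ => ((hc2 q).const_mul (p.2 q)).intervalIntegrable _ _),
    ← intervalIntegral.integral_add (hc1.intervalIntegrable _ _)
      ((continuous_finsetSum _ fun q _ => (hc2 q).const_mul (p.2 q)).intervalIntegrable _ _)]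
  have hder : ∀ t ∈ uIcc (0:ℝ) 1, HasDerivAt (fun t => t * f (chiJ t p))
      (f (chiJ t p) + ∑ q : JIdx n m s, p.2 q * (t * pdY q.1 q.2.1 f (chiJ t p))) t := by
    intro t _
    have e2 : HasFDerivAt f (fderiv ℝ f (chiJ t p)) (chiJ t p) :=
      ((hf.differentiableOn (by simp)).differentiableAt
        (hD.mem_nhds (show chiJ t p ∈ Cyl n m s U from hp))).hasFDerivAt
    have e1 : HasDerivAt (fun t : ℝ => chiJ t p) ((0, p.2) : Jet n m s) t := by
      refine HasDerivAt.prodMk (hasDerivAt_const t p.1) (hasDerivAt_pi.2 fun q => ?_)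
      simpa using (hasDerivAt_id t).mul_const (p.2 q)
    have e3 := (hasDerivAt_id t).fun_mul (e2.comp_hasDerivAt t e1)
    refine e3.congr_deriv ?_
    have h1 : ((0, p.2) : Jet n m s) = ∑ q : JIdx n m s, p.2 q •
        ((0, Pi.single q 1) : Jet n m s) := by
      refine Prod.ext ?_ ?_
      · simp [Prod.fst_sum]
      · funext q
        simp [Prod.snd_sum, Finset.sum_apply, Pi.single_apply]
    rw [h1, map_sum]
    simp only [map_smul, smul_eq_mul, id, one_mul, Finset.mul_sum]
    congr 1
    refine Finset.sum_congr rfl fun q _ => ?_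
    rw [pdY, dif_pos q.2.2]
    ring
  rw [intervalIntegral.integral_eq_sub_of_hasDerivAt hder
    ((hc1.add (continuous_finsetSum _ fun q _ =>
      (hc2 q).const_mul (p.2 q))).intervalIntegrable _ _)]
  simp [chiJ]

/-- extension of a finite jet by zero -/
def extJ {r : ℕ} (p : Jet n m r) : JInf n m := (p.1, fun q => yc q.1 q.2 p)

theorem trunc_extJ {r : ℕ} (p : Jet n m r) : trunc r (extJ p) = p := by
  refine Prod.ext rfl (funext fun q => ?_)
  simp only [trunc, extJ, yc]
  rw [dif_pos q.2.2]

theorem RI_sum {ι : Type*} (A : Finset ι) {F : ι → JInf n m → ℝ}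
    (hF : ∀ a ∈ A, Sm U (F a)) {P : JInf n m} (hP : P.1 ∈ U) :
    RI (fun P => ∑ a ∈ A, F a P) P = ∑ a ∈ A, RI (F a) P := by
  unfold RI
  simp only [Finset.mul_sum]
  refine intervalIntegral.integral_finsetSum fun a ha => Continuous.intervalIntegrable ?_ _ _
  obtain ⟨r, f, hf⟩ := hF a ha
  have : (fun t : ℝ => F a (chi t P)) = fun t => f (chiJ t (trunc r P)) :=
    funext fun t => hf.2 (chi t P) hP
  refine continuous_id.mul ?_
  rw [this]
  exact hf.1.continuousOn.comp_continuous (f := fun t : ℝ => chiJ t (trunc r P))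
    (by unfold chiJ; fun_prop) (fun t => hP)

theorem Sm.dJ (hU : IsOpen U) {F : JInf n m → ℝ} (h : Sm U F) (J : Fin n → ℕ) :
    Sm U (dJ J F) := h.TDL hU _

theorem RI_const_mul (c : ℝ) (F : JInf n m → ℝ) (P : JInf n m) :
    RI (fun P => c * F P) P = c * RI F P := by
  unfold RI
  rw [← intervalIntegral.integral_const_mul]
  refine intervalIntegral.integral_congr fun t _ => ?_
  ring

theorem RI_congr {F G : JInf n m → ℝ} (h : ∀ P : JInf n m, P.1 ∈ U → F P = G P)
    {P : JInf n m} (hP : P.1 ∈ U) : RI F P = RI G P := by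
  unfold RI
  refine intervalIntegral.integral_congr fun t _ => ?_
  rw [h (chi t P) hP]

/-- One summand of the Euler–Lagrange expression, after Leibniz and Helmholtz. -/
theorem key_sum (hU : IsOpen U) {s : ℕ} {T : Fin m → Jet n m s → ℝ}
    (hT : ∀ σ, ContDiffOn ℝ (⊤:ℕ∞) (T σ) (Cyl n m s U)) (σ ν : Fin m)
    (hHS : ∀ (J : Fin n → ℕ), (∑ i, J i) ≤ s →
      ∀ P : JInf n m, P.1 ∈ U →
        pdY ν J (T σ) (trunc s P) = (-1:ℝ)^(∑ i, J i) * LieEuler σ J (T ν) (trunc (2*s) P))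
    {P : JInf n m} (hP : P.1 ∈ U) :
    ∑ J : MD n s, (-1:ℝ)^(∑ i, J.1 i) * dJ J.1 (fun P => P.2 (ν, fun _ => 0) *
        RI (fun P => pdY σ J.1 (T ν) (trunc s P)) P) P
      = ∑ I : MD n s, P.2 (ν, I.1) * RI (fun P => pdY ν I.1 (T σ) (trunc s P)) P := by
  have hS : ∀ J, Sm U (fun P => pdY σ J (T ν) (trunc s P)) := fun J =>
    ⟨s, _, Rep.of (pdY_contDiffOn hU σ J (hT ν))⟩
  let a : (Fin n → ℕ) → (Fin n → ℕ) → ℝ := fun I K => (-1:ℝ)^(∑ i, (I i + K i)) *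
    (mch (fun i => I i + K i) I * (P.2 (ν, I) *
      RI (dJ K (fun P => pdY σ (fun i => I i + K i) (T ν) (trunc s P))) P))
  have e1 : ∀ J : MD n s, (-1:ℝ)^(∑ i, J.1 i) * dJ J.1 (fun P => P.2 (ν, fun _ => 0) *
        RI (fun P => pdY σ J.1 (T ν) (trunc s P)) P) P
      = ∑ I ∈ Finset.Iic J.1, a I (J.1 - I) := by
    intro J
    rw [leibniz hU ((hS J.1).RI hU) ν J.1 hP, Finset.mul_sum]
    refine Finset.sum_congr rfl fun I hI => ?_
    rw [Finset.mem_Iic] at hI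
    have e : (fun i => I i + (J.1 - I) i) = J.1 := by
      funext i
      have : I i ≤ J.1 i := hI i
      simp only [Pi.sub_apply]; omega
    have e' : ∑ i, (I i + (J.1 - I) i) = ∑ i, J.1 i := by
      conv_rhs => rw [← e]
    simp only [a]
    rw [e', e, dJ, TDL_RI hU (hS J.1) _ hP]
  rw [Finset.sum_congr rfl fun J _ => e1 J, reorg s a]
  refine Finset.sum_congr rfl fun I _ => ?_
  have e2 : RI (fun P => pdY ν I.1 (T σ) (trunc s P)) P
      = RI (fun P => ∑ K : MD n s, (if (∑ i, (I.1 i + K.1 i)) ≤ s then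
        (-1:ℝ)^(∑ i, (I.1 i + K.1 i)) * mch (fun i => I.1 i + K.1 i) I.1 else 0) *
        dJ K.1 (fun P => pdY σ (fun i => I.1 i + K.1 i) (T ν) (trunc s P)) P) P := by
    refine RI_congr (U := U) (fun P hP => ?_) hP
    rw [hHS I.1 I.2 P hP, LieEuler_eq hU σ I.1 (hT ν) hP, Finset.mul_sum]
    refine Finset.sum_congr rfl fun K _ => ?_
    split_ifs
    · rw [Finset.sum_add_distrib, pow_add]; ring
    · ring
  rw [e2, RI_sum (U := U) _ (fun K _ => (Sm.const _).mul ((hS _).dJ hU _)) hP, Finset.mul_sum]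
  refine Finset.sum_congr rfl fun K _ => ?_
  rw [RI_const_mul]
  simp only [a]
  split_ifs
  · ring
  · ring

theorem main_aux (hU : IsOpen U) {s : ℕ} {T : Fin m → Jet n m s → ℝ}
    (hT : ∀ σ, ContDiffOn ℝ (⊤:ℕ∞) (T σ) (Cyl n m s U)) (σ : Fin m)
    (hHS : ∀ (ν : Fin m) (J : Fin n → ℕ), (∑ i, J i) ≤ s →
      ∀ P : JInf n m, P.1 ∈ U →
        pdY ν J (T σ) (trunc s P) = (-1:ℝ)^(∑ i, J i) * LieEuler σ J (T ν) (trunc (2*s) P))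
    {P : JInf n m} (hP : P.1 ∈ U) :
    EL σ (TontiVainberg T) (trunc (2*s) P) = T σ (trunc s P) := by
  classical
  set K : JInf n m → ℝ := fun P => ∫ t in (0:ℝ)..1, T σ (chiJ t (trunc s P)) with hK
  have hSK : Sm U K := ⟨s, _, Rep.of (TV_contDiffOn hU hT σ)⟩
  have hS : ∀ ν J, Sm U (fun P => pdY σ J (T ν) (trunc s P)) := fun ν J =>
    ⟨s, _, Rep.of (pdY_contDiffOn hU σ J (hT ν))⟩
  unfold EL
  rw [LieEuler_eq hU σ _ (TontiVainberg_contDiffOn hU hT) hP]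
  have e1 : ∀ J : MD n s, (if (∑ i, (0 + J.1 i)) ≤ s then
      (-1:ℝ)^(∑ i, J.1 i) * mch (fun i => 0 + J.1 i) (fun _ => 0) *
        dJ J.1 (fun P => pdY σ (fun i => 0 + J.1 i) (TontiVainberg T) (trunc s P)) P else 0)
      = (if J.1 = (fun _ => 0) then K P else 0) +
        ∑ ν, (-1:ℝ)^(∑ i, J.1 i) * dJ J.1 (fun P => P.2 (ν, fun _ => 0) *
          RI (fun P => pdY σ J.1 (T ν) (trunc s P)) P) P := by
    intro J
    simp only [zero_add]
    rw [if_pos J.2]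
    have e2 : ∀ P : JInf n m, P.1 ∈ U → pdY σ J.1 (TontiVainberg T) (trunc s P)
        = (if J.1 = (fun _ => 0) then K else fun _ => 0) P + ∑ ν, P.2 (ν, fun _ => 0) *
          RI (fun P => pdY σ J.1 (T ν) (trunc s P)) P := by
      intro P hP
      rw [pdY_TV hU hT σ J.1 J.2 (p := trunc s P) hP]
      congr 1
      · split_ifs <;> rfl
      · refine Finset.sum_congr rfl fun ν _ => ?_
        rw [yc_trunc _ _ (by simp)]
        rfl
    have hs1 : Sm U (if J.1 = (fun _ => 0) then K else fun _ => 0) := by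
      split_ifs
      · exact hSK
      · exact Sm.const 0
    have hs2 : ∀ ν, Sm U (fun P : JInf n m => P.2 (ν, fun _ => 0) *
          RI (fun P => pdY σ J.1 (T ν) (trunc s P)) P) := fun ν =>
      (Sm.coord ν _).mul ((hS ν J.1).RI hU)
    have hm : mch J.1 (fun _ => 0) = 1 := by simp [mch]
    unfold dJ
    rw [hm, mul_one, TDL_congr hU e2 _ hP, TDL_add hU hs1 (Sm.sum _ fun ν _ => hs2 ν) _ hP,
      TDL_sum hU _ (fun ν _ => hs2 ν) _ hP, mul_add, Finset.mul_sum]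
    congr 1
    by_cases h0 : J.1 = fun _ => 0
    · rw [if_pos h0, if_pos h0, h0, mlist_zero]
      simp [TDL]
    · rw [if_neg h0, if_neg h0, TDL_zero hU _ hP, mul_zero]
  rw [Finset.sum_congr rfl fun J _ => e1 J, Finset.sum_add_distrib, Finset.sum_comm,
    Finset.sum_congr rfl fun ν _ => key_sum hU hT σ ν (hHS ν) hP]
  rw [← FTC_T hU (hT σ) (p := trunc s P) hP]
  congr 1
  · rw [Finset.sum_eq_single (⟨fun _ => 0, by simp⟩ : MD n s)]
    · simp [hK]
    · intro J _ hJ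
      rw [if_neg]
      exact fun h => hJ (Subtype.ext h)
    · simp
  · rw [Fintype.sum_prod_type]
    rfl

end Final

/-- a differential equation satisfying the Helmholtz conditions is
variational, with explicit (Tonti–Vainberg) Lagrangian. -/
theorem helmholtz_implies_variational (n m s : ℕ) (hn : 1 ≤ n) (hm : 1 ≤ m)
    (U : Set (Fin n → ℝ)) (hU : IsOpen U)
    (T : Fin m → Jet n m s → ℝ)
    (hT : ∀ σ, ContDiffOn ℝ (⊤:ℕ∞) (T σ) {p : Jet n m s | p.1 ∈ U})
    (hHS : ∀ (σ ν : Fin m) (J : Fin n → ℕ), (∑ i, J i) ≤ s →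
      ∀ p : Jet n m (2*s), p.1 ∈ U →
        pdY ν J (T σ) (projJet (by omega : s ≤ 2*s) p)
          - (-1:ℝ)^(∑ i, J i) * LieEuler σ J (T ν) p = 0) :
    ContDiffOn ℝ (⊤:ℕ∞) (TontiVainberg T) {p : Jet n m s | p.1 ∈ U} ∧
    ∀ (σ : Fin m) (p : Jet n m (2*s)), p.1 ∈ U →
      EL σ (TontiVainberg T) p = T σ (projJet (by omega : s ≤ 2*s) p) := by
  refine ⟨TontiVainberg_contDiffOn hU hT, fun σ p hp => ?_⟩
  have := main_aux hU hT σ (fun ν J hJ P hP => sub_eq_zero.1 (hHS σ ν J hJ (trunc (2*s) P) hP))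
    (P := extJ p) hp
  rw [trunc_extJ] at this
  rw [this]
  congr 1
  conv_rhs => rw [← trunc_extJ p]
  rfl


end JetVar
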